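/- Let K be a finite simple graph with vertex set V and edge set E, and suppose there is an enumeration v₁, …, vₙ of V such that for every i, the vertex vᵢ has at most 2 neighbors among v₁, …, v_{i−1}. Then the set of all tuples x ∈ SO(3)^V such that for every edge {v, w} ∈ E there exist unit quaternions q, p ∈ S³ with π(q) = x_v, π(p) = x_w and q p q⁻¹ p⁻¹ = −1, is a connected subspace of SO(3)^V. (This set is the fiber o_K^{−1}(Λ) of the obstruction map over the edge marking Λ assigning −1 to every edge; note that the condition forces x_v and x_w to commute.) -/

import Mathlib

noncomputable section

/-- `SO(3)`: the space of real `3 × 3` matrices `A` with `A * Aᵀ = 1` and `det A = 1`,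
topologized as a subspace of the space of matrices. -/
abbrev SO3 : Type := {A : Matrix (Fin 3) (Fin 3) ℝ // A * A.transpose = 1 ∧ A.det = 1}

/-- The representation variety `R(K, SO(3))`: the subspace of `SO(3)^V` of tuples whose
entries commute along the edges of `K`. -/
def RepVar {V : Type*} (K : SimpleGraph V) : Set (V → SO3) :=
  {x | ∀ v w : V, K.Adj v w → (x v).1 * (x w).1 = (x w).1 * (x v).1}

/-- The identification `ℝ³ ≅ Im(ℍ)` sending `v` to the purely imaginary quaternion
`v 0 · i + v 1 · j + v 2 · k`. -/
def imQuat (v : Fin 3 → ℝ) : Quaternion ℝ := ⟨0, v 0, v 1, v 2⟩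

/-- `QuatLift q x` says that the quaternion `q` is a lift of the rotation matrix `x` under
the conjugation covering homomorphism `π : S³ → SO(3)`, i.e. conjugation by `q` on the
purely imaginary quaternions agrees with the action of `x` on `ℝ³ ≅ Im(ℍ)`. -/
def QuatLift (q : Quaternion ℝ) (x : Matrix (Fin 3) (Fin 3) ℝ) : Prop :=
  ∀ v : Fin 3 → ℝ, q * imQuat v * q⁻¹ = imQuat (x.mulVec v)

/-- `IsObstruction K x Λ` says that the edge marking `Λ` (with values in `{±1} ≅ ℤˣ`) is the
value `o_K(x)` of the obstruction map at `x`: for each edge `{v, w}` of `K` there are unit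
quaternion lifts of `x v` and `x w` whose commutator is `Λ {v, w}`.  (The commutator of lifts
is independent of the choice of lifts, so this determines `Λ` on the edges of `K`.) -/
def IsObstruction {V : Type*} (K : SimpleGraph V) (x : V → SO3) (Λ : Sym2 V → ℤˣ) : Prop :=
  ∀ v w : V, K.Adj v w → ∃ q p : Quaternion ℝ, ‖q‖ = 1 ∧ ‖p‖ = 1 ∧
    QuatLift q (x v).1 ∧ QuatLift p (x w).1 ∧
    q * p * q⁻¹ * p⁻¹ = ((Λ s(v, w) : ℤ) : Quaternion ℝ)

open Matrix Set

/-- The unit sphere of `ℝ³`, cut out by the dot product. -/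
abbrev UnitVec : Type := {v : Fin 3 → ℝ // v ⬝ᵥ v = 1}

lemma UnitVec.sq_sum (u : UnitVec) : u.1 0 * u.1 0 + u.1 1 * u.1 1 + u.1 2 * u.1 2 = 1 := by
  simpa [dotProduct, Fin.sum_univ_three] using u.2

instance : CompactSpace UnitVec := by
  refine isCompact_iff_compactSpace.mp (Metric.isCompact_of_isClosed_isBounded ?_ ?_)
  · exact isClosed_eq (by fun_prop) continuous_const
  · refine (Metric.isBounded_closedBall (x := (0 : Fin 3 → ℝ)) (r := 1)).subset fun v hv => ?_
    have h := UnitVec.sq_sum ⟨v, hv⟩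
    simp only [mem_closedBall_zero_iff]
    refine (pi_norm_le_iff_of_nonneg zero_le_one).mpr fun i => ?_
    rw [Real.norm_eq_abs, abs_le_one_iff_mul_self_le_one]
    fin_cases i <;> dsimp at h ⊢ <;>
      nlinarith [mul_self_nonneg (v 0), mul_self_nonneg (v 1), mul_self_nonneg (v 2)]

lemma dotProduct_self_pos {n : Type*} [Fintype n] {w : n → ℝ} (hw : w ≠ 0) : 0 < w ⬝ᵥ w :=
  lt_of_le_of_ne (Finset.sum_nonneg fun i _ => mul_self_nonneg (w i))
    fun h => hw (dotProduct_self_eq_zero.mp h.symm)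

/-- The normalization of a nonzero vector. -/
def UnitVec.normalize (w : Fin 3 → ℝ) (hw : w ≠ 0) : UnitVec :=
  ⟨(√(w ⬝ᵥ w))⁻¹ • w, by
    have h := dotProduct_self_pos hw
    have h2 := Real.mul_self_sqrt h.le
    have h3 : √(w ⬝ᵥ w) ≠ 0 := (Real.sqrt_pos.mpr h).ne'
    rw [smul_dotProduct, dotProduct_smul, smul_eq_mul, smul_eq_mul]
    field_simp
    rw [sq, h2]⟩

/-- The rotation by `π` about the axis spanned by `u`. -/
def halfTurn (u : UnitVec) : SO3 :=
  ⟨(2 : ℝ) • vecMulVec u.1 u.1 - 1, by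
    have h := u.sq_sum
    constructor
    · ext i j
      fin_cases i <;> fin_cases j <;>
        simp [Matrix.mul_apply, Fin.sum_univ_three, vecMulVec_apply]
      · linear_combination 4 * u.1 0 * u.1 0 * h
      · linear_combination 4 * u.1 0 * u.1 1 * h
      · linear_combination 4 * u.1 0 * u.1 2 * h
      · linear_combination 4 * u.1 1 * u.1 0 * h
      · linear_combination 4 * u.1 1 * u.1 1 * h
      · linear_combination 4 * u.1 1 * u.1 2 * h
      · linear_combination 4 * u.1 2 * u.1 0 * h
      · linear_combination 4 * u.1 2 * u.1 1 * h
      · linear_combination 4 * u.1 2 * u.1 2 * h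
    · simp [Matrix.det_fin_three, vecMulVec_apply]
      linear_combination 2 * h⟩

lemma continuous_halfTurn : Continuous halfTurn := by
  refine Continuous.subtype_mk ?_ _
  exact ((continuous_subtype_val.matrix_vecMulVec continuous_subtype_val).const_smul (2 : ℝ)).sub
    continuous_const

lemma halfTurn_mulVec (u : UnitVec) (v : Fin 3 → ℝ) :
    (halfTurn u).1 *ᵥ v = (2 * (u.1 ⬝ᵥ v)) • u.1 - v := by
  simp [halfTurn, sub_mulVec, smul_mulVec, vecMulVec_mulVec, mul_smul]

lemma halfTurn_eq_of_neg {u w : UnitVec} (h : w.1 = -u.1) : halfTurn w = halfTurn u := by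
  simp [halfTurn, h]

lemma eq_or_eq_neg_of_halfTurn_eq {u w : UnitVec} (h : halfTurn u = halfTurn w) :
    u.1 = w.1 ∨ u.1 = -w.1 := by
  have h1 := halfTurn_mulVec u u.1
  rw [h, halfTurn_mulVec, u.2] at h1
  have h2 : u.1 = (w.1 ⬝ᵥ u.1) • w.1 := by
    have : (2 : ℝ) • u.1 = (2 : ℝ) • ((w.1 ⬝ᵥ u.1) • w.1) := by
      linear_combination (norm := module) -h1
    exact smul_right_injective _ two_ne_zero this
  have h3 : (w.1 ⬝ᵥ u.1) * (w.1 ⬝ᵥ u.1) = 1 := by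
    have := u.2
    rw [h2, smul_dotProduct, dotProduct_smul, w.2] at this
    simpa using this
  rcases mul_self_eq_one_iff.mp h3 with h | h <;> rw [h] at h2 <;> simp_all

/-- `PerpHalfTurns A B` says that `A` and `B` are rotations by `π` about orthogonal axes. -/
def PerpHalfTurns (A B : SO3) : Prop :=
  ∃ u w : UnitVec, u.1 ⬝ᵥ w.1 = 0 ∧ halfTurn u = A ∧ halfTurn w = B

lemma PerpHalfTurns.symm {A B : SO3} : PerpHalfTurns A B → PerpHalfTurns B A :=
  fun ⟨u, w, h, hu, hw⟩ => ⟨w, u, dotProduct_comm u.1 w.1 ▸ h, hw, hu⟩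

lemma perpHalfTurns_halfTurn {u w : UnitVec} :
    PerpHalfTurns (halfTurn u) (halfTurn w) ↔ u.1 ⬝ᵥ w.1 = 0 := by
  refine ⟨?_, fun h => ⟨u, w, h, rfl, rfl⟩⟩
  rintro ⟨u', w', h, hu, hw⟩
  rcases eq_or_eq_neg_of_halfTurn_eq hu with h1 | h1 <;>
    rcases eq_or_eq_neg_of_halfTurn_eq hw with h2 | h2 <;> simpa [h1, h2] using h

lemma isClosed_perpHalfTurns : IsClosed {p : SO3 × SO3 | PerpHalfTurns p.1 p.2} := by
  have : {p : SO3 × SO3 | PerpHalfTurns p.1 p.2} =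
      Prod.map halfTurn halfTurn '' {p : UnitVec × UnitVec | p.1.1 ⬝ᵥ p.2.1 = 0} := by
    ext ⟨A, B⟩
    simp [PerpHalfTurns]
  rw [this]
  refine IsCompact.isClosed (IsCompact.image (IsClosed.isCompact ?_) ?_)
  · exact isClosed_eq (by fun_prop) continuous_const
  · exact continuous_halfTurn.prodMap continuous_halfTurn

/-- Two vectors of `ℝ³` have a common orthogonal unit vector. -/
lemma exists_unitVec_perp (a b : Fin 3 → ℝ) : ∃ w : UnitVec, a ⬝ᵥ w.1 = 0 ∧ b ⬝ᵥ w.1 = 0 := by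
  have hdet : (Matrix.of ![a, b, b]).det = 0 :=
    det_zero_of_row_eq (i := 1) (j := 2) (by decide) rfl
  obtain ⟨v, hv, h⟩ := exists_mulVec_eq_zero_iff.mpr hdet
  have h0 : a ⬝ᵥ v = 0 := congrFun h 0
  have h1 : b ⬝ᵥ v = 0 := congrFun h 1
  exact ⟨UnitVec.normalize v hv, by simp [UnitVec.normalize, h0], by simp [UnitVec.normalize, h1]⟩

/-- The half turns about the lines of a linear subspace form a preconnected set. -/
lemma isPreconnected_halfTurn_image (W : Submodule ℝ (Fin 3 → ℝ)) :
    IsPreconnected (halfTurn '' {u | u.1 ∈ W}) := by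
  refine isPreconnected_of_forall_pair ?_
  rintro _ ⟨u, hu, rfl⟩ _ ⟨w, hw, rfl⟩
  by_cases hneg : w.1 = -u.1
  · exact ⟨{halfTurn u}, singleton_subset_iff.mpr ⟨u, hu, rfl⟩, rfl, halfTurn_eq_of_neg hneg,
      isPreconnected_singleton⟩
  let γ : unitInterval → Fin 3 → ℝ := fun t => (1 - t.1) • u.1 + t.1 • w.1
  have hγ : ∀ t, γ t ≠ 0 := by
    intro t ht
    have h1 : t.1 • w.1 = -((1 - t.1) • u.1) := eq_neg_of_add_eq_zero_right ht
    have h2 : t.1 * t.1 = (1 - t.1) * (1 - t.1) := by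
      have := congrArg (fun v => v ⬝ᵥ v) h1
      simp [u.2, w.2] at this
      linarith
    have h3 : t.1 = 1 / 2 := by linarith
    apply hneg
    rw [h3] at h1
    have : (1 / 2 : ℝ) • w.1 = (1 / 2 : ℝ) • (-u.1) := by rw [h1]; norm_num
    exact smul_right_injective _ (by norm_num) this
  have hcont : Continuous γ := by fun_prop
  let δ : unitInterval → SO3 := fun t => halfTurn (UnitVec.normalize (γ t) (hγ t))
  have hδ : Continuous δ := by
    refine continuous_halfTurn.comp (Continuous.subtype_mk ?_ _)
    refine Continuous.smul
      (Continuous.inv₀ (hcont.dotProduct hcont).sqrt fun t => ?_) hcont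
    exact (Real.sqrt_pos.mpr (dotProduct_self_pos (hγ t))).ne'
  refine ⟨range δ, ?_, ⟨0, ?_⟩, ⟨1, ?_⟩, isPreconnected_range hδ⟩
  · rintro _ ⟨t, rfl⟩
    exact ⟨_, W.smul_mem _ (W.add_mem (W.smul_mem _ hu) (W.smul_mem _ hw)), rfl⟩
  · exact congrArg halfTurn (Subtype.ext (by simp [γ, UnitVec.normalize, u.2]))
  · exact congrArg halfTurn (Subtype.ext (by simp [γ, UnitVec.normalize, w.2]))

/-- The half turns perpendicular to at most two given half turns form a connected set. -/
lemma isConnected_perpHalfTurns {T : Finset SO3} (hT : ∀ A ∈ T, A ∈ range halfTurn)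
    (hcard : T.card ≤ 2) :
    IsConnected {B ∈ range halfTurn | ∀ A ∈ T, PerpHalfTurns A B} := by
  obtain ⟨a, b, hab⟩ : ∃ a b : Fin 3 → ℝ, ∀ u : UnitVec, halfTurn u ∈ T →
      ∃ c : ℝ, u.1 = c • a ∨ u.1 = c • b := by
    have key : ∀ u v : UnitVec, halfTurn u = halfTurn v → ∃ c : ℝ, u.1 = c • v.1 := by
      intro u v h
      rcases eq_or_eq_neg_of_halfTurn_eq h with h | h
      · exact ⟨1, by simpa using h⟩
      · exact ⟨-1, by simpa using h⟩
    obtain h | h | h : T.card = 0 ∨ T.card = 1 ∨ T.card = 2 := by omega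
    · exact ⟨0, 0, by simp [Finset.card_eq_zero.mp h]⟩
    · obtain ⟨A, rfl⟩ := Finset.card_eq_one.mp h
      obtain ⟨a, rfl⟩ := hT A (by simp)
      exact ⟨a.1, 0, fun u hu => (key u a (by simpa using hu)).imp fun _ => Or.inl⟩
    · obtain ⟨A, B, -, rfl⟩ := Finset.card_eq_two.mp h
      obtain ⟨a, rfl⟩ := hT A (by simp)
      obtain ⟨b, rfl⟩ := hT B (by simp)
      refine ⟨a.1, b.1, fun u hu => ?_⟩
      rcases (by simpa using hu : halfTurn u = halfTurn a ∨ halfTurn u = halfTurn b) with h | h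
      · exact (key u a h).imp fun _ => Or.inl
      · exact (key u b h).imp fun _ => Or.inr
  let W : Submodule ℝ (Fin 3 → ℝ) :=
    { carrier := {w | ∀ u : UnitVec, halfTurn u ∈ T → u.1 ⬝ᵥ w = 0}
      add_mem' := fun hx hy u hu => by rw [dotProduct_add, hx u hu, hy u hu, add_zero]
      zero_mem' := fun u _ => dotProduct_zero _
      smul_mem' := fun c x hx u hu => by rw [dotProduct_smul, hx u hu, smul_zero] }
  have hW : {B ∈ range halfTurn | ∀ A ∈ T, PerpHalfTurns A B} = halfTurn '' {u | u.1 ∈ W} := by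
    ext B
    constructor
    · rintro ⟨⟨w, rfl⟩, h⟩
      exact ⟨w, fun u hu => perpHalfTurns_halfTurn.mp (h _ hu), rfl⟩
    · rintro ⟨w, hw, rfl⟩
      refine ⟨⟨w, rfl⟩, fun A hA => ?_⟩
      obtain ⟨u, rfl⟩ := hT A hA
      exact perpHalfTurns_halfTurn.mpr (hw u hA)
  rw [hW]
  refine ⟨?_, isPreconnected_halfTurn_image W⟩
  obtain ⟨w, ha, hb⟩ := exists_unitVec_perp a b
  refine ⟨_, w, fun u hu => ?_, rfl⟩
  obtain ⟨c, h | h⟩ := hab u hu <;> simp [h, ha, hb]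

/-- A compact set with connected image and preconnected fibers is connected. -/
lemma IsCompact.isConnected_of_fibers {X Y : Type*} [TopologicalSpace X] [TopologicalSpace Y]
    [T2Space Y] {s : Set X} {f : X → Y} (hs : IsCompact s) (hf : Continuous f)
    (himage : IsConnected (f '' s)) (hfib : ∀ y ∈ f '' s, IsPreconnected (s ∩ f ⁻¹' {y})) :
    IsConnected s := by
  refine ⟨himage.nonempty.of_image, isPreconnected_closed_iff.mpr fun t t' ht ht' hst hnt hnt' => ?_⟩
  have hclosed : ∀ {t}, IsClosed t → IsClosed (f '' (s ∩ t)) := fun ht =>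
    ((hs.inter_right ht).image hf).isClosed
  obtain ⟨y, hy, ⟨a, ⟨has, hat⟩, rfl⟩, b, ⟨hbs, hbt⟩, hab⟩ :=
    isPreconnected_closed_iff.mp himage.isPreconnected _ _ (hclosed ht) (hclosed ht')
      (by rw [← image_union, ← inter_union_distrib_left]
          exact image_mono (subset_inter subset_rfl hst))
      (by obtain ⟨a, ha⟩ := hnt
          exact ⟨f a, mem_image_of_mem f ha.1, mem_image_of_mem f ha⟩)
      (by obtain ⟨a, ha⟩ := hnt'
          exact ⟨f a, mem_image_of_mem f ha.1, mem_image_of_mem f ha⟩)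
  obtain ⟨c, hc, hc'⟩ := isPreconnected_closed_iff.mp (hfib _ hy) t t' ht ht'
    (inter_subset_left.trans hst) ⟨a, ⟨has, rfl⟩, hat⟩ ⟨b, ⟨hbs, hab⟩, hbt⟩
  exact ⟨c, hc.1, hc'⟩

/-- Assignments of half turns to the vertices of `G`, perpendicular along edges. -/
def perpTuples {V : Type*} (G : SimpleGraph V) : Set (V → SO3) :=
  {x | (∀ i, x i ∈ range halfTurn) ∧ ∀ i j, G.Adj i j → PerpHalfTurns (x i) (x j)}

lemma isCompact_perpTuples {V : Type*} (G : SimpleGraph V) : IsCompact (perpTuples G) := by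
  have h1 : IsCompact (univ.pi fun _ : V => range halfTurn) :=
    isCompact_univ_pi fun _ => isCompact_range continuous_halfTurn
  have h2 : IsClosed {x : V → SO3 | ∀ i j, G.Adj i j → PerpHalfTurns (x i) (x j)} := by
    simp only [ofPred_forall]
    exact isClosed_iInter fun i => isClosed_iInter fun j => isClosed_iInter fun _ =>
      isClosed_perpHalfTurns.preimage
        (f := fun x : V → SO3 => (x i, x j)) (by fun_prop)
  convert! h1.inter_right h2 using 1
  ext x
  simp [perpTuples]

lemma isConnected_perpTuples {n : ℕ} (G : SimpleGraph (Fin n))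
    (hG : ∀ i : Fin n, Nat.card {j : Fin n // j < i ∧ G.Adj i j} ≤ 2) :
    IsConnected (perpTuples G) := by
  classical
  induction n with
  | zero =>
    have : perpTuples G = {Fin.elim0} := by
      ext x
      simp [perpTuples, Subsingleton.elim x Fin.elim0]
    rw [this]
    exact isConnected_singleton
  | succ n ih =>
    have hconn := ih (G.comap Fin.castSucc) fun i => by
      refine (Nat.card_le_card_of_injective (fun j => ⟨j.1.castSucc,
        Fin.castSucc_lt_castSucc_iff.mpr j.2.1, j.2.2⟩) fun j k h => ?_).trans (hG i.castSucc)
      simpa [Subtype.ext_iff] using h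
    have hfib : ∀ y ∈ perpTuples (G.comap Fin.castSucc),
        IsConnected (perpTuples G ∩ Fin.init (α := fun _ => SO3) ⁻¹' {y}) := by
      intro y hy
      let N : Finset (Fin n) := {j | G.Adj (Fin.last n) j.castSucc}
      have hN : N.card ≤ 2 := by
        rw [← Nat.card_eq_finsetCard]
        refine (Nat.card_le_card_of_injective (fun j => ⟨j.1.castSucc, Fin.castSucc_lt_last _,
          (Finset.mem_filter.mp j.2).2⟩) fun j k h => ?_).trans (hG (Fin.last n))
        exact Subtype.ext (Fin.castSucc_injective n (congrArg Subtype.val h))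
      have hT := isConnected_perpHalfTurns (T := N.image y)
        (fun A hA => by
          obtain ⟨j, -, rfl⟩ := Finset.mem_image.mp hA
          exact hy.1 j) (Finset.card_image_le.trans hN)
      have hsnoc : Continuous fun B : SO3 => (Fin.snoc (α := fun _ => SO3) y B) :=
        Continuous.finSnoc (A := fun _ => SO3) continuous_const continuous_id
      convert! hT.image _ hsnoc.continuousOn using 1
      ext x
      constructor
      · rintro ⟨⟨hx1, hx2⟩, rfl⟩
        refine ⟨x (Fin.last n), ⟨hx1 _, fun A hA => ?_⟩, Fin.snoc_init_self x⟩
        obtain ⟨j, hj, rfl⟩ := Finset.mem_image.mp hA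
        exact (hx2 _ _ (by simpa [N] using hj)).symm
      · rintro ⟨B, ⟨hB, hBT⟩, rfl⟩
        have hadj : ∀ j : Fin n, G.Adj (Fin.last n) j.castSucc → PerpHalfTurns (y j) B :=
          fun j hj => hBT _ (Finset.mem_image_of_mem y (by simpa [N] using hj))
        refine ⟨⟨fun i => ?_, fun i j hij => ?_⟩, Fin.init_snoc (α := fun _ => SO3) B y⟩
        · induction i using Fin.lastCases with
          | last => simpa using hB
          | cast i => simpa using hy.1 i
        · induction i using Fin.lastCases with
          | last =>
            induction j using Fin.lastCases with
            | last => exact absurd hij G.irrefl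
            | cast j => simpa using (hadj j hij).symm
          | cast i =>
            induction j using Fin.lastCases with
            | last => simpa using hadj i hij.symm
            | cast j => simpa using hy.2 i j hij
    have himage : Fin.init (α := fun _ => SO3) '' perpTuples G =
        perpTuples (G.comap Fin.castSucc) := by
      apply Subset.antisymm
      · rintro _ ⟨x, hx, rfl⟩
        exact ⟨fun i => hx.1 _, fun i j hij => hx.2 _ _ hij⟩
      · intro y hy
        obtain ⟨x, hx, hxy⟩ := (hfib y hy).nonempty
        exact ⟨x, hx, hxy⟩
    refine (isCompact_perpTuples G).isConnected_of_fibers (f := Fin.init (α := fun _ => SO3))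
      (continuous_pi fun i => continuous_apply _) (himage ▸ hconn) ?_
    rw [himage]
    exact fun y hy => (hfib y hy).isPreconnected

/-- Rotations preserve the cross product. -/
lemma SO3.mulVec_cross (A : SO3) (a b : Fin 3 → ℝ) :
    A.1 *ᵥ (a ⨯₃ b) = (A.1 *ᵥ a) ⨯₃ (A.1 *ᵥ b) := by
  have h : A.1ᵀ *ᵥ ((A.1 *ᵥ a) ⨯₃ (A.1 *ᵥ b)) = A.1.det • (a ⨯₃ b) := by
    ext i
    fin_cases i <;>
      simp [cross_apply, mulVec, dotProduct, Fin.sum_univ_three, det_fin_three] <;> ring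
  rw [A.2.2, one_smul] at h
  rw [← h, mulVec_mulVec, A.2.1, one_mulVec]

lemma SO3.dotProduct_mulVec (A : SO3) (a b : Fin 3 → ℝ) :
    (A.1 *ᵥ a) ⬝ᵥ (A.1 *ᵥ b) = a ⬝ᵥ b := by
  rw [Matrix.dotProduct_mulVec, vecMul_mulVec, mul_eq_one_comm.mp A.2.1, vecMul_one]

/-- Every rotation has an axis. -/
lemma SO3.exists_fixed (A : SO3) : ∃ u : UnitVec, A.1 *ᵥ u.1 = u.1 := by
  have hdet : (A.1 - 1).det = 0 := by
    have h1 : (A.1 - 1).det = -(A.1 - 1).det := by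
      calc (A.1 - 1).det = (A.1 * (1 - A.1)ᵀ).det := by
            rw [transpose_sub, mul_sub, A.2.1, transpose_one, mul_one]
        _ = (-(A.1 - 1)).det := by rw [det_mul, A.2.2, one_mul, det_transpose, neg_sub]
        _ = -(A.1 - 1).det := by rw [det_neg]; simp [pow_succ]
    linarith
  obtain ⟨v, hv, h⟩ := exists_mulVec_eq_zero_iff.mpr hdet
  rw [sub_mulVec, one_mulVec, sub_eq_zero] at h
  exact ⟨UnitVec.normalize v hv, by simp [UnitVec.normalize, mulVec_smul, h]⟩

/-- The product of two rotations. -/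
def SO3.mul (A B : SO3) : SO3 :=
  ⟨A.1 * B.1, by
    rw [transpose_mul, Matrix.mul_assoc, ← Matrix.mul_assoc B.1, B.2.1, Matrix.one_mul, A.2.1],
    by rw [det_mul, A.2.2, B.2.2, mul_one]⟩

lemma halfTurn_mul_self (u : UnitVec) : (halfTurn u).1 * (halfTurn u).1 = 1 := by
  have h := (halfTurn u).2.1
  have ht : (halfTurn u).1ᵀ = (halfTurn u).1 := by
    simp [halfTurn, transpose_vecMulVec]
  rwa [ht] at h

/-- A rotation that reverses some nonzero vector is a half turn. -/
lemma SO3.eq_halfTurn (A : SO3) (n : UnitVec) (hn : A.1 *ᵥ n.1 = -n.1) :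
    ∃ m, halfTurn m = A := by
  obtain ⟨m, hm⟩ := A.exists_fixed
  have hmn : m.1 ⬝ᵥ n.1 = 0 := by
    have := A.dotProduct_mulVec m.1 n.1
    rw [hm, hn, dotProduct_neg] at this
    linarith
  refine ⟨m, Subtype.ext ?_⟩
  have hhm : (halfTurn m).1 *ᵥ m.1 = m.1 := by
    rw [halfTurn_mulVec, m.2]; module
  have hhn : (halfTurn m).1 *ᵥ n.1 = -n.1 := by
    rw [halfTurn_mulVec, hmn]; module
  let P : Matrix (Fin 3) (Fin 3) ℝ := (Matrix.of ![m.1, n.1, m.1 ⨯₃ n.1])ᵀ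
  have hP : IsUnit P := by
    rw [isUnit_iff_isUnit_det]
    have h1 := cross_dot_cross m.1 n.1 m.1 n.1
    rw [m.2, n.2, hmn, dotProduct_comm n.1, hmn] at h1
    have h2 : P.det = (m.1 ⨯₃ n.1) ⬝ᵥ (m.1 ⨯₃ n.1) := by
      simp [P, cross_apply, det_fin_three, dotProduct, Fin.sum_univ_three]
      ring
    rw [h2, h1]
    simp
  have hcol : ∀ (B : Matrix (Fin 3) (Fin 3) ℝ) (j : Fin 3), (B * P).col j = B *ᵥ (P.col j) :=
    fun _ _ => rfl
  refine hP.mul_right_cancel (ext_col fun j => ?_)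
  rw [hcol, hcol]
  fin_cases j
  · exact hhm.trans hm.symm
  · exact hhn.trans hn.symm
  · change (halfTurn m).1 *ᵥ (m.1 ⨯₃ n.1) = A.1 *ᵥ (m.1 ⨯₃ n.1)
    rw [SO3.mulVec_cross, SO3.mulVec_cross, hhm, hhn, hm, hn]

/-- Every rotation is a product of two half turns. -/
lemma SO3.exists_eq_mul_halfTurn (A : SO3) :
    ∃ u w : UnitVec, SO3.mul (halfTurn u) (halfTurn w) = A := by
  obtain ⟨n, hn⟩ := A.exists_fixed
  obtain ⟨w, hw, -⟩ := exists_unitVec_perp n.1 0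
  obtain ⟨u, hu⟩ := (SO3.mul A (halfTurn w)).eq_halfTurn n (by
    rw [SO3.mul, ← mulVec_mulVec, halfTurn_mulVec, dotProduct_comm, hw]
    simp [mulVec_neg, hn])
  refine ⟨u, w, Subtype.ext ?_⟩
  rw [hu, SO3.mul, SO3.mul]
  dsimp only
  rw [Matrix.mul_assoc, halfTurn_mul_self, Matrix.mul_one]

instance : ConnectedSpace SO3 := by
  have h : IsConnected (range halfTurn) := by
    have := isConnected_perpHalfTurns (T := ∅) (by simp) (by simp)
    convert! this using 1
    ext
    simp
  have hmul : Continuous fun p : SO3 × SO3 => SO3.mul p.1 p.2 :=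
    Continuous.subtype_mk (by fun_prop) _
  have := (h.prod h).image _ hmul.continuousOn
  rw [connectedSpace_iff_univ]
  convert! this using 1
  refine (eq_univ_of_forall fun A => ?_).symm
  obtain ⟨u, w, rfl⟩ := A.exists_eq_mul_halfTurn
  exact ⟨(halfTurn u, halfTurn w), ⟨⟨u, rfl⟩, ⟨w, rfl⟩⟩, rfl⟩

lemma imQuat_injective : Function.Injective imQuat := by
  intro v w h
  have h1 := congrArg QuaternionAlgebra.imI h
  have h2 := congrArg QuaternionAlgebra.imJ h
  have h3 := congrArg QuaternionAlgebra.imK h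
  ext i
  fin_cases i <;> assumption

@[simp] lemma imQuat_re (v : Fin 3 → ℝ) : (imQuat v).re = 0 := rfl

@[simp] lemma imQuat_imI (v : Fin 3 → ℝ) : (imQuat v).imI = v 0 := rfl

@[simp] lemma imQuat_imJ (v : Fin 3 → ℝ) : (imQuat v).imJ = v 1 := rfl

@[simp] lemma imQuat_imK (v : Fin 3 → ℝ) : (imQuat v).imK = v 2 := rfl

lemma imQuat_mul_imQuat (u v : Fin 3 → ℝ) :
    imQuat u * imQuat v = -((u ⬝ᵥ v : ℝ) : Quaternion ℝ) + imQuat (u ⨯₃ v) := by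
  ext <;> simp [dotProduct, Fin.sum_univ_three, cross_apply] <;> ring

lemma UnitVec.imQuat_inv (u : UnitVec) : (imQuat u.1)⁻¹ = -imQuat u.1 := by
  refine inv_eq_of_mul_eq_one_right ?_
  rw [mul_neg, imQuat_mul_imQuat, u.2, cross_self]
  ext <;> simp

lemma UnitVec.norm_imQuat (u : UnitVec) : ‖imQuat u.1‖ = 1 := by
  have h : ‖imQuat u.1‖ * ‖imQuat u.1‖ = 1 := by
    rw [← Quaternion.normSq_eq_norm_mul_self, Quaternion.normSq_def']
    simpa [sq] using u.sq_sum
  nlinarith [norm_nonneg (imQuat u.1)]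

lemma quatLift_halfTurn (u : UnitVec) : QuatLift (imQuat u.1) (halfTurn u).1 := by
  intro v
  rw [u.imQuat_inv, halfTurn_mulVec]
  have h := u.sq_sum
  ext <;> simp [dotProduct, Fin.sum_univ_three]
  · ring
  · linear_combination -v 0 * h
  · linear_combination -v 1 * h
  · linear_combination -v 2 * h

lemma QuatLift.eq {q : Quaternion ℝ} {A B : SO3} (hA : QuatLift q A.1) (hB : QuatLift q B.1) :
    A = B :=
  Subtype.ext (ext_of_mulVec_single fun _ => imQuat_injective ((hA _).symm.trans (hB _)))

/-- A purely imaginary unit quaternion lifts the half turn about its axis. -/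
lemma exists_unitVec_of_re_eq_zero {q : Quaternion ℝ} (hq : ‖q‖ = 1) (hre : q.re = 0) :
    ∃ u : UnitVec, imQuat u.1 = q := by
  refine ⟨⟨![q.imI, q.imJ, q.imK], ?_⟩, ?_⟩
  · have h := Quaternion.normSq_eq_norm_mul_self q
    rw [Quaternion.normSq_def', hq, hre] at h
    simp [dotProduct, Fin.sum_univ_three]
    linarith
  · ext <;> simp [hre]

lemma re_eq_zero_of_anticommute {q p : Quaternion ℝ} (hp : p ≠ 0) (h : q * p = -(p * q)) :
    q.re = 0 := by
  have h0 := congrArg QuaternionAlgebra.re h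
  have h1 := congrArg QuaternionAlgebra.imI h
  have h2 := congrArg QuaternionAlgebra.imJ h
  have h3 := congrArg QuaternionAlgebra.imK h
  simp at h0 h1 h2 h3
  have hpos : Quaternion.normSq p ≠ 0 := Quaternion.normSq_ne_zero.mpr hp
  rw [Quaternion.normSq_def'] at hpos
  refine (mul_eq_zero.mp (?_ : q.re * _ = 0)).resolve_right hpos
  linear_combination (p.re * h0 + p.imI * h1 + p.imJ * h2 + p.imK * h3) / 2

/-- Two rotations have anticommuting lifts if and only if they are half turns about orthogonal
axes. -/
lemma exists_lifts_commutator_eq_neg_one_iff (A B : SO3) :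
    (∃ q p : Quaternion ℝ, ‖q‖ = 1 ∧ ‖p‖ = 1 ∧ QuatLift q A.1 ∧ QuatLift p B.1 ∧
      q * p * q⁻¹ * p⁻¹ = -1) ↔ PerpHalfTurns A B := by
  constructor
  · rintro ⟨q, p, hq, hp, hqA, hpB, h⟩
    have hq0 : q ≠ 0 := norm_ne_zero_iff.mp (by simp [hq])
    have hp0 : p ≠ 0 := norm_ne_zero_iff.mp (by simp [hp])
    have hqp : q * p = -(p * q) := by
      rw [mul_inv_eq_iff_eq_mul₀ hp0, mul_inv_eq_iff_eq_mul₀ hq0] at h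
      rw [h, neg_one_mul, neg_mul]
    obtain ⟨u, rfl⟩ := exists_unitVec_of_re_eq_zero hq (re_eq_zero_of_anticommute hp0 hqp)
    obtain ⟨w, rfl⟩ := exists_unitVec_of_re_eq_zero hp
      (re_eq_zero_of_anticommute hq0 (by rw [hqp, neg_neg]))
    refine ⟨u, w, ?_, (quatLift_halfTurn u).eq hqA, (quatLift_halfTurn w).eq hpB⟩
    rw [imQuat_mul_imQuat, imQuat_mul_imQuat] at hqp
    have := congrArg QuaternionAlgebra.re hqp
    simp [dotProduct_comm w.1] at this
    linarith
  · rintro ⟨u, w, huw, rfl, rfl⟩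
    refine ⟨imQuat u.1, imQuat w.1, u.norm_imQuat, w.norm_imQuat, quatLift_halfTurn u,
      quatLift_halfTurn w, ?_⟩
    have hq0 : imQuat u.1 ≠ 0 := norm_ne_zero_iff.mp (by simp [u.norm_imQuat])
    have hp0 : imQuat w.1 ≠ 0 := norm_ne_zero_iff.mp (by simp [w.norm_imQuat])
    rw [mul_inv_eq_iff_eq_mul₀ hp0, mul_inv_eq_iff_eq_mul₀ hq0, neg_one_mul, neg_mul,
      imQuat_mul_imQuat, imQuat_mul_imQuat, dotProduct_comm w.1, huw]
    ext <;> simp [cross_apply] <;> ring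

theorem allNegOne_fiber_isConnected
    {V : Type} [Fintype V] (K : SimpleGraph V)
    (n : ℕ) (e : Fin n ≃ V)
    (horder : ∀ i : Fin n, Nat.card {j : Fin n // j < i ∧ K.Adj (e i) (e j)} ≤ 2) :
    IsConnected {x : V → SO3 | ∀ v w : V, K.Adj v w →
      ∃ q p : Quaternion ℝ, ‖q‖ = 1 ∧ ‖p‖ = 1 ∧
        QuatLift q (x v).1 ∧ QuatLift p (x w).1 ∧
        q * p * q⁻¹ * p⁻¹ = -1} := by
  classical
  simp only [exists_lifts_commutator_eq_neg_one_iff]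
  let Φ : (Fin n → SO3) × (V → SO3) → V → SO3 := fun p v =>
    if ∃ w, K.Adj v w then p.1 (e.symm v) else p.2 v
  have hΦ : Continuous Φ := by
    refine continuous_pi fun v => ?_
    by_cases hv : ∃ w, K.Adj v w
    · simp only [Φ, if_pos hv]
      fun_prop
    · simp only [Φ, if_neg hv]
      fun_prop
  convert! ((isConnected_perpTuples (K.comap e) horder).prod
    (isConnected_univ (α := V → SO3))).image Φ hΦ.continuousOn using 1
  ext x
  constructor
  · intro hx
    obtain ⟨u, -⟩ := exists_unitVec_perp 0 0
    refine ⟨(fun i => if ∃ w, K.Adj (e i) w then x (e i) else halfTurn u, x),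
      ⟨⟨fun i => ?_, fun i j hij => ?_⟩, mem_univ _⟩, funext fun v => ?_⟩
    · dsimp only
      split_ifs with h
      · obtain ⟨w, hw⟩ := h
        obtain ⟨u, _, -, hu, -⟩ := hx _ _ hw
        exact ⟨u, hu⟩
      · exact ⟨u, rfl⟩
    · have hij' : K.Adj (e i) (e j) := hij
      dsimp only
      rw [if_pos ⟨_, hij'⟩, if_pos ⟨_, hij'.symm⟩]
      exact hx _ _ hij'
    · by_cases hv : ∃ w, K.Adj v w <;> simp [Φ, hv]
  · rintro ⟨⟨z, y⟩, ⟨hz, -⟩, rfl⟩ v w hvw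
    simp only [Φ]
    rw [if_pos ⟨_, hvw⟩, if_pos ⟨_, hvw.symm⟩]
    exact hz.2 _ _ (by simpa using hvw)

end
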